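/- arXiv:1406.1747 — 7 statements merged into one kernel-verified Lean document; each statement's English description precedes it below -/
import Mathlib

section
/- Let d be a positive integer, let x ∈ ℝ^d with ‖x‖_{ℓ1} = 1, let x̃ ∈ ℝ^d with x̃ ≠ 0, and let λ ∈ ℝ. Then ‖ sign(λ)·(x̃ / ‖x̃‖_{ℓ1}) − x ‖_{ℓ1} ≤ 2‖x̃ − λx‖_{ℓ1} / ‖x̃‖_{ℓ1}. -/
theorem abs_sign_le_one (r : ℝ) : |Real.sign r| ≤ 1 := by
  rcases Real.sign_apply_eq r with h | h | h <;> simp [h]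

theorem abs_sum_abs_sub_sum_abs_le {ι : Type*} (s : Finset ι) (f g : ι → ℝ) :
    |(∑ i ∈ s, |f i|) - (∑ i ∈ s, |g i|)| ≤ ∑ i ∈ s, |f i - g i| := by
  rw [← Finset.sum_sub_distrib]
  exact (Finset.abs_sum_le_sum_abs _ _).trans
    (Finset.sum_le_sum fun i _ => abs_abs_sub_abs_le (f i) (g i))

theorem stmt_0 (d : ℕ) (hd : 0 < d) (x xt : Fin d → ℝ)
    (hx : ∑ i, |x i| = 1) (hxt : xt ≠ 0) (lam : ℝ) :
    ∑ i, |Real.sign lam * (xt i / ∑ j, |xt j|) - x i| ≤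
      2 * (∑ i, |xt i - lam * x i|) / ∑ i, |xt i| := by
  have hN : 0 < ∑ j, |xt j| := by
    obtain ⟨i, hi⟩ := Function.ne_iff.mp hxt
    exact Finset.sum_pos' (fun j _ => abs_nonneg (xt j))
      ⟨i, Finset.mem_univ i, abs_pos.mpr hi⟩
  have hD := abs_sum_abs_sub_sum_abs_le Finset.univ xt (fun i => lam * x i)
  simp only [abs_mul, ← Finset.mul_sum, hx, mul_one] at hD
  rw [abs_sub_comm] at hD
  set N := ∑ j, |xt j|
  set D := ∑ i, |xt i - lam * x i|
  have hs : Real.sign lam * lam = |lam| := by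
    rcases lt_trichotomy lam 0 with h | h | h
    · simp [Real.sign_of_neg h, abs_of_neg h]
    · simp [h]
    · simp [Real.sign_of_pos h, abs_of_pos h]
  have key (i : Fin d) : |Real.sign lam * (xt i / N) - x i| ≤
      (|xt i - lam * x i| + D * |x i|) / N := by
    have e : Real.sign lam * (xt i / N) - x i =
        (Real.sign lam * (xt i - lam * x i) + (|lam| - N) * x i) / N := by
      rw [← hs]
      field_simp
      ring
    rw [e, abs_div, abs_of_pos hN]
    gcongr
    refine (abs_add_le _ _).trans (add_le_add ?_ ?_)
    · rw [abs_mul]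
      exact mul_le_of_le_one_left (abs_nonneg _) (abs_sign_le_one lam)
    · rw [abs_mul]
      gcongr
  refine (Finset.sum_le_sum fun i _ => key i).trans_eq ?_
  rw [← Finset.sum_div, Finset.sum_add_distrib, ← Finset.mul_sum, hx, mul_one, two_mul]
end

section
/- Let V be a real normed vector space, let x ∈ V with ‖x‖ = 1, let x̃ ∈ V with x̃ ≠ 0, and let λ ∈ ℝ. Then ‖ sign(λ)·(x̃ / ‖x̃‖) − x ‖ ≤ 2‖x̃ − λx‖ / ‖x̃‖. -/
theorem stmt_1 {V : Type*} [NormedAddCommGroup V] [NormedSpace ℝ V]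
    (x xt : V) (hx : ‖x‖ = 1) (hxt : xt ≠ 0) (lam : ℝ) :
    ‖Real.sign lam • (‖xt‖⁻¹ • xt) - x‖ ≤ 2 * ‖xt - lam • x‖ / ‖xt‖ := by
  have hn : 0 < ‖xt‖ := norm_pos_iff.mpr hxt
  have hs : |Real.sign lam| ≤ 1 := by
    rcases Real.sign_apply_eq lam with h | h | h <;> simp [h]
  have hsl : Real.sign lam * lam = |lam| := by
    rcases lt_trichotomy lam 0 with h | h | h
    · simp [Real.sign_of_neg h, abs_of_neg h]
    · simp [h]
    · simp [Real.sign_of_pos h, abs_of_pos h]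
  have hscale : ‖xt‖ • (Real.sign lam • (‖xt‖⁻¹ • xt) - x)
      = Real.sign lam • (xt - lam • x) + (|lam| - ‖xt‖) • x := by
    rw [smul_sub, smul_comm, smul_inv_smul₀ hn.ne', smul_sub, smul_smul, hsl, sub_smul]
    abel
  have hsign : ‖Real.sign lam • (xt - lam • x)‖ ≤ ‖xt - lam • x‖ := by
    rw [norm_smul, Real.norm_eq_abs]
    exact mul_le_of_le_one_left (norm_nonneg _) hs
  have hlen : ‖(|lam| - ‖xt‖) • x‖ ≤ ‖xt - lam • x‖ := by
    have h := abs_norm_sub_norm_le xt (lam • x)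
    rwa [norm_smul, hx, mul_one, Real.norm_eq_abs, abs_sub_comm, ← Real.norm_eq_abs (_ - _),
      ← mul_one ‖|lam| - ‖xt‖‖, ← hx, ← norm_smul] at h
  rw [le_div_iff₀ hn, mul_comm]
  calc ‖xt‖ * ‖Real.sign lam • (‖xt‖⁻¹ • xt) - x‖
      = ‖Real.sign lam • (xt - lam • x) + (|lam| - ‖xt‖) • x‖ := by
        rw [← hscale, norm_smul, norm_norm]
    _ ≤ ‖xt - lam • x‖ + ‖xt - lam • x‖ := norm_add_le_of_le hsign hlen
    _ = 2 * ‖xt - lam • x‖ := (two_mul _).symm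
end

section
/- Let d be a positive integer, let a ∈ ℝ^d with ‖a‖_{ℓ1} = 1, let 0 < h ≤ 1, let c₁ > 0, and let g : ℝ → ℝ be differentiable on [−1,1] with |g′(t₁) − g′(t₂)| ≤ c₁|t₁ − t₂| for all t₁, t₂ ∈ [−1,1]. Define ã ∈ ℝ^d by ã_i = (g(h a_i) − g(0))/h for i = 1, …, d. Then ∑_{i=1}^d |ã_i − g′(0) a_i| ≤ c₁ h ‖a‖_{ℓ2}², where ‖a‖_{ℓ2}² = ∑_{i=1}^d a_i². -/
theorem abs_taylor_remainder_le_of_lipschitz_deriv {s : Set ℝ} (hs : Convex ℝ s) {g g' : ℝ → ℝ}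
    {c x₀ x : ℝ} (hc : 0 ≤ c) (hx₀ : x₀ ∈ s) (hx : x ∈ s)
    (hg : ∀ t ∈ s, HasDerivWithinAt g (g' t) s t)
    (hlip : ∀ t ∈ s, |g' t - g' x₀| ≤ c * |t - x₀|) :
    |g x - g x₀ - g' x₀ * (x - x₀)| ≤ c * (x - x₀) ^ 2 := by
  have hsub : Set.uIcc x₀ x ⊆ s := hs.ordConnected.uIcc_subset hx₀ hx
  have hderiv : ∀ t ∈ Set.uIcc x₀ x,
      HasDerivWithinAt (fun t ↦ g t - g' x₀ * t) (g' t - g' x₀) (Set.uIcc x₀ x) t := by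
    intro t ht
    simpa only [mul_one, id] using ((hg t (hsub ht)).mono hsub).fun_sub
      ((hasDerivWithinAt_id t (Set.uIcc x₀ x)).const_mul (g' x₀))
  have hbound : ∀ t ∈ Set.uIcc x₀ x, ‖g' t - g' x₀‖ ≤ c * |x - x₀| := fun t ht ↦
    (hlip t (hsub ht)).trans
      (mul_le_mul_of_nonneg_left (Set.abs_sub_left_of_mem_uIcc ht) hc)
  have hmv := (convex_uIcc x₀ x).norm_image_sub_le_of_norm_hasDerivWithin_le hderiv hbound
    Set.left_mem_uIcc Set.right_mem_uIcc
  calc |g x - g x₀ - g' x₀ * (x - x₀)|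
      = ‖g x - g' x₀ * x - (g x₀ - g' x₀ * x₀)‖ := by rw [Real.norm_eq_abs]; ring_nf
    _ ≤ c * |x - x₀| * |x - x₀| := hmv
    _ = c * (x - x₀) ^ 2 := by rw [mul_assoc, abs_mul_abs_self, sq]

theorem stmt_3 (d : ℕ) (hd : 0 < d) (a : Fin d → ℝ) (ha : ∑ i, |a i| = 1)
    (h : ℝ) (hh0 : 0 < h) (hh1 : h ≤ 1) (c₁ : ℝ) (hc₁ : 0 < c₁)
    (g g' : ℝ → ℝ)
    (hg : ∀ t ∈ Set.Icc (-1 : ℝ) 1, HasDerivWithinAt g (g' t) (Set.Icc (-1 : ℝ) 1) t)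
    (hlip : ∀ t₁ ∈ Set.Icc (-1 : ℝ) 1, ∀ t₂ ∈ Set.Icc (-1 : ℝ) 1,
      |g' t₁ - g' t₂| ≤ c₁ * |t₁ - t₂|)
    (at' : Fin d → ℝ) (hat : ∀ i, at' i = (g (h * a i) - g 0) / h) :
    ∑ i, |at' i - g' 0 * a i| ≤ c₁ * h * ∑ i, (a i) ^ 2 := by
  rw [Finset.mul_sum]
  refine Finset.sum_le_sum fun i _ ↦ ?_
  have hai : |a i| ≤ 1 :=
    ha ▸ Finset.single_le_sum (f := fun i ↦ |a i|) (fun j _ ↦ abs_nonneg _) (Finset.mem_univ i)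
  have hmem : h * a i ∈ Set.Icc (-1 : ℝ) 1 := by
    rw [Set.mem_Icc, ← abs_le, abs_mul, abs_of_pos hh0]
    exact mul_le_one₀ hh1 (abs_nonneg _) hai
  have h0 : (0 : ℝ) ∈ Set.Icc (-1 : ℝ) 1 := by norm_num
  have hrem := abs_taylor_remainder_le_of_lipschitz_deriv (convex_Icc (-1 : ℝ) 1) hc₁.le h0 hmem hg
    fun t ht ↦ hlip t ht 0 h0
  have heq : at' i - g' 0 * a i = (g (h * a i) - g 0 - g' 0 * (h * a i - 0)) / h := by
    rw [hat]; field_simp; ring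
  rw [heq, abs_div, abs_of_pos hh0, div_le_iff₀ hh0]
  exact hrem.trans_eq (by ring)
end

section
/- Let d be a positive integer, let a ∈ ℝ^d with ‖a‖_{ℓ1} = 1, let 0 < h ≤ 1, let c₁ > 0, and let g : ℝ → ℝ be differentiable on [−1,1] with |g′(t₁) − g′(t₂)| ≤ c₁|t₁ − t₂| for all t₁, t₂ ∈ [−1,1] and g′(0) > 0. Define ã ∈ ℝ^d by ã_i = (g(h a_i) − g(0))/h for i = 1, …, d. Then ‖ã‖_{ℓ1} ≥ g′(0) − c₁ h. -/
/-- First-order Taylor estimate at `0` for a function on `[-1, 1]` whose derivative is Lipschitz. -/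
theorem abs_sub_sub_mul_le_of_lipschitz_deriv {c : ℝ} (hc : 0 ≤ c) {g g' : ℝ → ℝ}
    (hg : ∀ t ∈ Set.Icc (-1 : ℝ) 1, HasDerivWithinAt g (g' t) (Set.Icc (-1 : ℝ) 1) t)
    (hlip : ∀ t ∈ Set.Icc (-1 : ℝ) 1, |g' t - g' 0| ≤ c * |t|)
    {x : ℝ} (hx : |x| ≤ 1) : |g x - g 0 - g' 0 * x| ≤ c * |x| * |x| := by
  have hsub : Set.uIcc 0 x ⊆ Set.Icc (-1 : ℝ) 1 :=
    Set.uIcc_subset_Icc (by norm_num) (abs_le.mp hx)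
  have hderiv : ∀ t ∈ Set.uIcc 0 x,
      HasDerivWithinAt (fun t => g t - g' 0 * t) (g' t - g' 0) (Set.uIcc 0 x) t := by
    intro t ht
    simpa only [id_eq, mul_one] using! ((hg t (hsub ht)).mono hsub).sub
      ((hasDerivWithinAt_id t _).const_mul (g' 0))
  have hbound : ∀ t ∈ Set.uIcc 0 x, ‖g' t - g' 0‖ ≤ c * |x| := by
    intro t ht
    have htx : |t| ≤ |x| := by simpa using Set.abs_sub_left_of_mem_uIcc ht
    exact (hlip t (hsub ht)).trans (mul_le_mul_of_nonneg_left htx hc)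
  have key := (convex_uIcc (0 : ℝ) x).norm_image_sub_le_of_norm_hasDerivWithin_le hderiv hbound
    Set.left_mem_uIcc Set.right_mem_uIcc
  simp only [Real.norm_eq_abs, mul_zero, sub_zero] at key
  rwa [sub_right_comm] at key

theorem stmt_4 (d : ℕ) (hd : 0 < d) (a : Fin d → ℝ) (ha : ∑ i, |a i| = 1)
    (h : ℝ) (hh0 : 0 < h) (hh1 : h ≤ 1) (c₁ : ℝ) (hc₁ : 0 < c₁)
    (g g' : ℝ → ℝ)
    (hg : ∀ t ∈ Set.Icc (-1 : ℝ) 1, HasDerivWithinAt g (g' t) (Set.Icc (-1 : ℝ) 1) t)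
    (hlip : ∀ t₁ ∈ Set.Icc (-1 : ℝ) 1, ∀ t₂ ∈ Set.Icc (-1 : ℝ) 1,
      |g' t₁ - g' t₂| ≤ c₁ * |t₁ - t₂|)
    (hg'0 : 0 < g' 0)
    (at' : Fin d → ℝ) (hat : ∀ i, at' i = (g (h * a i) - g 0) / h) :
    g' 0 - c₁ * h ≤ ∑ i, |at' i| := by
  have hterm : ∀ i, |a i| * (g' 0 - c₁ * h) ≤ |at' i| := by
    intro i
    have hai : |a i| ≤ 1 :=
      ha ▸ Finset.single_le_sum (f := fun j => |a j|) (fun j _ => abs_nonneg _) (Finset.mem_univ i)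
    have hx : |h * a i| = h * |a i| := by rw [abs_mul, abs_of_pos hh0]
    have hx1 : |h * a i| ≤ 1 := hx ▸ mul_le_one₀ hh1 (abs_nonneg _) hai
    have htaylor := abs_sub_sub_mul_le_of_lipschitz_deriv hc₁.le hg
      (fun t ht => by simpa using hlip t ht 0 (by norm_num)) hx1
    have hmain : |g' 0 * (h * a i)| = g' 0 * (h * |a i|) := by rw [abs_mul, hx, abs_of_pos hg'0]
    have htri := abs_sub_abs_le_abs_sub (g' 0 * (h * a i)) (g (h * a i) - g 0)
    rw [abs_sub_comm (g' 0 * (h * a i)), hmain] at htri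
    rw [hx] at htaylor
    have hsq : c₁ * (h * |a i|) * (h * |a i|) ≤ c₁ * (h * |a i|) * h :=
      mul_le_mul_of_nonneg_left (mul_le_of_le_one_right hh0.le hai) (by positivity)
    rw [hat, abs_div, abs_of_pos hh0, le_div_iff₀ hh0]
    linarith
  calc g' 0 - c₁ * h = ∑ i, |a i| * (g' 0 - c₁ * h) := by rw [← Finset.sum_mul, ha, one_mul]
    _ ≤ ∑ i, |at' i| := Finset.sum_le_sum fun i _ => hterm i
end

section
/- Let d, m be positive integers, let φ_1, …, φ_m ∈ ℝ^d with ‖φ_j‖_{ℓ∞} ≤ 1/√m for each j, let a ∈ ℝ^d with ‖a‖_{ℓ1} = 1, let 0 < h ≤ √m, let c₁ > 0, and let g : ℝ → ℝ be differentiable on [−1,1] with |g′(t₁) − g′(t₂)| ≤ c₁|t₁ − t₂| for all t₁, t₂ ∈ [−1,1]. Define b̃_j = (g(h⟨a,φ_j⟩) − g(0))/h for j = 1, …, m. Then ∑_{j=1}^m |b̃_j − g′(0)⟨a,φ_j⟩| ≤ c₁ h. -/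
/-- First-order Taylor bound at `0` for a function on `[-1, 1]` with Lipschitz derivative. -/
theorem abs_sub_sub_deriv_mul_le {c : ℝ} (hc : 0 ≤ c) {g g' : ℝ → ℝ}
    (hg : ∀ t ∈ Set.Icc (-1 : ℝ) 1, HasDerivWithinAt g (g' t) (Set.Icc (-1 : ℝ) 1) t)
    (hlip : ∀ t ∈ Set.Icc (-1 : ℝ) 1, |g' t - g' 0| ≤ c * |t|)
    {x : ℝ} (hx : |x| ≤ 1) :
    |g x - g 0 - g' 0 * x| ≤ c * x ^ 2 := by
  have hsub : Set.Icc (-|x|) |x| ⊆ Set.Icc (-1 : ℝ) 1 :=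
    Set.Icc_subset_Icc (neg_le_neg hx) hx
  have key := (convex_Icc (-|x|) |x|).norm_image_sub_le_of_norm_hasDerivWithin_le
    (f := fun t => g t - g' 0 * t) (f' := fun t => g' t - g' 0 * 1) (C := c * |x|)
    (x := 0) (y := x)
    (fun t ht => ((hg t (hsub ht)).mono hsub).sub ((hasDerivWithinAt_id t _).const_mul (g' 0)))
    (fun t ht => by
      rw [mul_one, Real.norm_eq_abs]
      exact (hlip t (hsub ht)).trans (mul_le_mul_of_nonneg_left (abs_le.2 ht) hc))
    ⟨neg_nonpos.2 (abs_nonneg x), abs_nonneg x⟩ (abs_le.1 le_rfl)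
  calc |g x - g 0 - g' 0 * x| = ‖g x - g' 0 * x - (g 0 - g' 0 * 0)‖ := by
        rw [Real.norm_eq_abs]
        congr 1
        ring
    _ ≤ c * |x| * ‖x - 0‖ := key
    _ = c * x ^ 2 := by rw [sub_zero, Real.norm_eq_abs, mul_assoc, abs_mul_abs_self, sq]

/-- Hölder's inequality for the `ℓ1` and `ℓ∞` norms, with explicit bound on the second factor. -/
theorem abs_sum_mul_le_sum_abs_mul {ι : Type*} [Fintype ι] (a b : ι → ℝ) {B : ℝ}
    (hb : ∀ i, |b i| ≤ B) : |∑ i, a i * b i| ≤ (∑ i, |a i|) * B := by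
  rw [Finset.sum_mul]
  refine (Finset.abs_sum_le_sum_abs _ _).trans (Finset.sum_le_sum fun i _ => ?_)
  rw [abs_mul]
  exact mul_le_mul_of_nonneg_left (hb i) (abs_nonneg _)

theorem stmt_8 (d m : ℕ) (hd : 0 < d) (hm : 0 < m)
    (φ : Fin m → Fin d → ℝ) (hφ : ∀ j i, |φ j i| ≤ 1 / Real.sqrt m)
    (a : Fin d → ℝ) (ha : ∑ i, |a i| = 1)
    (h : ℝ) (hh0 : 0 < h) (hhm : h ≤ Real.sqrt m)
    (c₁ : ℝ) (hc₁ : 0 < c₁)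
    (g g' : ℝ → ℝ)
    (hg : ∀ t ∈ Set.Icc (-1 : ℝ) 1, HasDerivWithinAt g (g' t) (Set.Icc (-1 : ℝ) 1) t)
    (hlip : ∀ t₁ ∈ Set.Icc (-1 : ℝ) 1, ∀ t₂ ∈ Set.Icc (-1 : ℝ) 1,
      |g' t₁ - g' t₂| ≤ c₁ * |t₁ - t₂|)
    (bt : Fin m → ℝ)
    (hbt : ∀ j, bt j = (g (h * ∑ i, a i * φ j i) - g 0) / h) :
    ∑ j, |bt j - g' 0 * ∑ i, a i * φ j i| ≤ c₁ * h := by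
  have hm' : (0 : ℝ) < m := Nat.cast_pos.2 hm
  have hsqrt : 0 < Real.sqrt m := Real.sqrt_pos.2 hm'
  have hterm : ∀ j, |bt j - g' 0 * ∑ i, a i * φ j i| ≤ c₁ * h / m := by
    intro j
    have hs := abs_sum_mul_le_sum_abs_mul a (φ j) (hφ j)
    rw [ha, one_mul] at hs
    rw [hbt j]
    generalize ∑ i, a i * φ j i = s at hs ⊢
    have hx : |h * s| ≤ 1 := by
      rw [abs_mul, abs_of_pos hh0]
      calc h * |s| ≤ Real.sqrt m * (1 / Real.sqrt m) := by gcongr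
        _ = 1 := mul_one_div_cancel hsqrt.ne'
    have hsq : s ^ 2 ≤ 1 / m := by
      rw [← sq_abs]
      calc |s| ^ 2 ≤ (1 / Real.sqrt (m : ℝ)) ^ 2 := by gcongr
        _ = 1 / (m : ℝ) := by rw [div_pow, one_pow, Real.sq_sqrt hm'.le]
    have htaylor := abs_sub_sub_deriv_mul_le hc₁.le hg
      (fun t ht => by simpa using hlip t ht 0 (by simp)) hx
    have heq : (g (h * s) - g 0) / h - g' 0 * s = (g (h * s) - g 0 - g' 0 * (h * s)) / h := by
      field_simp
    rw [heq, abs_div, abs_of_pos hh0, div_le_iff₀ hh0]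
    calc _ ≤ c₁ * (h * s) ^ 2 := htaylor
      _ = c₁ * h ^ 2 * s ^ 2 := by ring
      _ ≤ c₁ * h ^ 2 * (1 / m) := by gcongr
      _ = c₁ * h / m * h := by ring
  calc _ ≤ ∑ _j : Fin m, c₁ * h / m := Finset.sum_le_sum fun j _ => hterm j
    _ = c₁ * h := by
      rw [Finset.sum_const, Finset.card_univ, Fintype.card_fin, nsmul_eq_mul,
        mul_div_cancel₀ _ hm'.ne']
end

section
/- Let d be a positive integer, let a ∈ ℝ^d with ‖a‖_{ℓ2} = 1, let 0 < h ≤ 2, let c₁ > 0, and let g : ℝ → ℝ be differentiable on [0,4] with |g′(t₁) − g′(t₂)| ≤ c₁|t₁ − t₂| for all t₁, t₂ ∈ [0,4]. Define ã ∈ ℝ^d by ã_i = ( g(‖a − (h/2)e_i‖_{ℓ2}²) − g(‖a + (h/2)e_i‖_{ℓ2}²) )/h, where e_i are the canonical basis vectors. Then ‖ã + 2g′(1)·a‖_{ℓ2} ≤ 2c₁(h + h²/4). -/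
theorem EuclideanSpace.norm_le_mul_norm_of_abs_apply_le {ι : Type*} [Fintype ι] {C : ℝ}
    (hC : 0 ≤ C) {x y : EuclideanSpace ℝ ι} (hxy : ∀ i, |x i| ≤ C * |y i|) :
    ‖x‖ ≤ C * ‖y‖ := by
  refine le_of_sq_le_sq ?_ (by positivity)
  rw [mul_pow, EuclideanSpace.norm_sq_eq, EuclideanSpace.norm_sq_eq, Finset.mul_sum]
  refine Finset.sum_le_sum fun i _ => ?_
  rw [← mul_pow, Real.norm_eq_abs, Real.norm_eq_abs]
  exact pow_le_pow_left₀ (abs_nonneg _) (hxy i) 2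

theorem abs_image_sub_sub_deriv_mul_le {g g' : ℝ → ℝ} {s : Set ℝ} (hs : Convex ℝ s)
    (hg : ∀ t ∈ s, HasDerivWithinAt g (g' t) s t) {c : ℝ} (hc : 0 ≤ c) {p : ℝ} (hp : p ∈ s)
    (hlip : ∀ t₁ ∈ s, ∀ t₂ ∈ s, |g' t₁ - g' t₂| ≤ c * |t₁ - t₂|) {r u v : ℝ}
    (hu : u ∈ s) (hv : v ∈ s) (hur : |u - p| ≤ r) (hvr : |v - p| ≤ r) :
    |g v - g u - g' p * (v - u)| ≤ c * r * |v - u| := by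
  have hconv : Convex ℝ (s ∩ Metric.closedBall p r) := hs.inter (convex_closedBall p r)
  have key := hconv.norm_image_sub_le_of_norm_hasDerivWithin_le
    (f := fun t => g t - g' p * t) (f' := fun t => g' t - g' p) (C := c * r) (x := u) (y := v)
    (fun t ht => by
      simpa using ((hg t ht.1).mono Set.inter_subset_left).fun_sub
        ((hasDerivWithinAt_id t _).const_mul (g' p)))
    (fun t ht => (hlip t ht.1 p hp).trans (mul_le_mul_of_nonneg_left ht.2 hc))
    ⟨hu, hur⟩ ⟨hv, hvr⟩
  simp only [Real.norm_eq_abs] at key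
  convert key using 2
  ring

theorem EuclideanSpace.norm_add_single_sq {ι : Type*} [Fintype ι] [DecidableEq ι]
    (a : EuclideanSpace ℝ ι) (i : ι) (t : ℝ) :
    ‖a + EuclideanSpace.single i t‖ ^ 2 = ‖a‖ ^ 2 + 2 * t * a i + t ^ 2 := by
  rw [norm_add_sq_real, EuclideanSpace.inner_single_right]
  simp
  ring

theorem stmt_14 (d : ℕ) (hd : 0 < d) (a : EuclideanSpace ℝ (Fin d)) (ha : ‖a‖ = 1)
    (h : ℝ) (hh0 : 0 < h) (hh2 : h ≤ 2) (c₁ : ℝ) (hc₁ : 0 < c₁)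
    (g g' : ℝ → ℝ)
    (hg : ∀ t ∈ Set.Icc (0 : ℝ) 4, HasDerivWithinAt g (g' t) (Set.Icc (0 : ℝ) 4) t)
    (hlip : ∀ t₁ ∈ Set.Icc (0 : ℝ) 4, ∀ t₂ ∈ Set.Icc (0 : ℝ) 4,
      |g' t₁ - g' t₂| ≤ c₁ * |t₁ - t₂|)
    (at' : EuclideanSpace ℝ (Fin d))
    (hat : ∀ i, at' i =
      (g (‖a - EuclideanSpace.single i (h / 2)‖ ^ 2) -
        g (‖a + EuclideanSpace.single i (h / 2)‖ ^ 2)) / h) :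
    ‖at' + (2 * g' 1) • a‖ ≤ 2 * c₁ * (h + h ^ 2 / 4) := by
  have hC : 0 ≤ 2 * c₁ * (h + h ^ 2 / 4) := by positivity
  have hmain := EuclideanSpace.norm_le_mul_norm_of_abs_apply_le hC
    (x := at' + (2 * g' 1) • a) (y := a) fun i => ?_
  · simpa [ha] using hmain
  have hai : |a i| ≤ 1 := by simpa [ha] using PiLp.norm_apply_le a i
  obtain ⟨hl, hr⟩ := abs_le.mp hai
  have hplus : ‖a + EuclideanSpace.single i (h / 2)‖ ^ 2 = 1 + h * a i + h ^ 2 / 4 := by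
    rw [EuclideanSpace.norm_add_single_sq, ha]; ring
  have hminus : ‖a - EuclideanSpace.single i (h / 2)‖ ^ 2 = 1 - h * a i + h ^ 2 / 4 := by
    have hneg : a - EuclideanSpace.single i (h / 2) = a + EuclideanSpace.single i (-(h / 2)) := by
      rw [sub_eq_add_neg]; congr 1; ext j; simp; split_ifs <;> simp
    rw [hneg, EuclideanSpace.norm_add_single_sq, ha]; ring
  have hnonneg_plus : 0 ≤ 1 + h * a i + h ^ 2 / 4 := hplus ▸ sq_nonneg _
  have hnonneg_minus : 0 ≤ 1 - h * a i + h ^ 2 / 4 := hminus ▸ sq_nonneg _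
  have h1 : h * a i ≤ h := by nlinarith
  have h2 : -h ≤ h * a i := by nlinarith
  have h3 : h ^ 2 ≤ 4 := by nlinarith
  have h4 : 0 ≤ h ^ 2 := sq_nonneg h
  have key := abs_image_sub_sub_deriv_mul_le (convex_Icc 0 4) hg hc₁.le (p := 1)
    (by norm_num) hlip (r := h + h ^ 2 / 4)
    (u := 1 + h * a i + h ^ 2 / 4) (v := 1 - h * a i + h ^ 2 / 4)
    ⟨hnonneg_plus, by linarith⟩ ⟨hnonneg_minus, by linarith⟩
    (abs_le.mpr ⟨by linarith, by linarith⟩) (abs_le.mpr ⟨by linarith, by linarith⟩)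
  have hcoord : (at' + (2 * g' 1) • a) i =
      (g (1 - h * a i + h ^ 2 / 4) - g (1 + h * a i + h ^ 2 / 4) -
        g' 1 * ((1 - h * a i + h ^ 2 / 4) - (1 + h * a i + h ^ 2 / 4))) / h := by
    rw [PiLp.add_apply, PiLp.smul_apply, hat i, hplus, hminus, smul_eq_mul]
    field_simp
    ring
  rw [hcoord, abs_div, abs_of_pos hh0, div_le_iff₀ hh0]
  refine key.trans_eq ?_
  rw [show (1 - h * a i + h ^ 2 / 4) - (1 + h * a i + h ^ 2 / 4) = -(2 * h * a i) by ring,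
    abs_neg, abs_mul, abs_of_pos (by positivity : 0 < 2 * h)]
  ring
end

section
/- Let d be a positive integer, let a ∈ ℝ^d with ‖a‖_{ℓ2} = 1, let 0 < h ≤ 2, let c₁ > 0, and let g : ℝ → ℝ be differentiable on [0,4] with |g′(t₁) − g′(t₂)| ≤ c₁|t₁ − t₂| for all t₁, t₂ ∈ [0,4], and assume g′(1) − c₁(h + h²/4) > 0. Define ã ∈ ℝ^d by ã_i = ( g(‖a − (h/2)e_i‖_{ℓ2}²) − g(‖a + (h/2)e_i‖_{ℓ2}²) )/h, where e_i are the canonical basis vectors. Then ‖ã‖_{ℓ2} ≥ 2(g′(1) − c₁(h + h²/4)). -/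
theorem mul_abs_sub_le_of_le_hasDerivWithinAt {g g' : ℝ → ℝ} {u v s t M : ℝ}
    (hg : ∀ x ∈ Set.Icc u v, HasDerivWithinAt g (g' x) (Set.Icc u v) x)
    (hs : s ∈ Set.Icc u v) (ht : t ∈ Set.Icc u v)
    (hM : ∀ x ∈ Set.uIcc s t, M ≤ g' x) :
    M * |s - t| ≤ |g s - g t| := by
  wlog hst : s ≤ t generalizing s t
  · rw [abs_sub_comm s, abs_sub_comm (g s)]
    exact this ht hs (by rwa [Set.uIcc_comm]) (le_of_not_ge hst)
  rcases hst.eq_or_lt with rfl | hlt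
  · simp
  obtain ⟨x, hx, hslope⟩ := exists_hasDerivAt_eq_slope g g' hlt
    (fun x hx => ((hg x ⟨hs.1.trans hx.1, hx.2.trans ht.2⟩).continuousWithinAt).mono
      (Set.Icc_subset_Icc hs.1 ht.2))
    (fun x hx => (hg x ⟨hs.1.trans hx.1.le, hx.2.le.trans ht.2⟩).hasDerivAt
      (Icc_mem_nhds (hs.1.trans_lt hx.1) (hx.2.trans_le ht.2)))
  have hMx := hM x (by rw [Set.uIcc_of_le hst]; exact ⟨hx.1.le, hx.2.le⟩)
  rw [hslope, le_div_iff₀ (sub_pos.2 hlt)] at hMx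
  rw [abs_sub_comm s, abs_sub_comm (g s), abs_of_pos (sub_pos.2 hlt)]
  exact hMx.trans (le_abs_self _)

theorem EuclideanSpace.norm_le_norm_of_abs_apply_le {ι : Type*} [Fintype ι]
    {x y : EuclideanSpace ℝ ι} (hxy : ∀ i, |x i| ≤ |y i|) : ‖x‖ ≤ ‖y‖ := by
  rw [EuclideanSpace.norm_eq, EuclideanSpace.norm_eq]
  refine Real.sqrt_le_sqrt (Finset.sum_le_sum fun i _ => ?_)
  exact pow_le_pow_left₀ (norm_nonneg _) (hxy i) 2

theorem stmt_15 (d : ℕ) (hd : 0 < d) (a : EuclideanSpace ℝ (Fin d)) (ha : ‖a‖ = 1)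
    (h : ℝ) (hh0 : 0 < h) (hh2 : h ≤ 2) (c₁ : ℝ) (hc₁ : 0 < c₁)
    (g g' : ℝ → ℝ)
    (hg : ∀ t ∈ Set.Icc (0 : ℝ) 4, HasDerivWithinAt g (g' t) (Set.Icc (0 : ℝ) 4) t)
    (hlip : ∀ t₁ ∈ Set.Icc (0 : ℝ) 4, ∀ t₂ ∈ Set.Icc (0 : ℝ) 4,
      |g' t₁ - g' t₂| ≤ c₁ * |t₁ - t₂|)
    (hpos : 0 < g' 1 - c₁ * (h + h ^ 2 / 4))
    (at' : EuclideanSpace ℝ (Fin d))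
    (hat : ∀ i, at' i =
      (g (‖a - EuclideanSpace.single i (h / 2)‖ ^ 2) -
        g (‖a + EuclideanSpace.single i (h / 2)‖ ^ 2)) / h) :
    2 * (g' 1 - c₁ * (h + h ^ 2 / 4)) ≤ ‖at'‖ := by
  set M := g' 1 - c₁ * (h + h ^ 2 / 4) with hM
  have hnorm : ‖(2 * M) • a‖ = 2 * M := by
    rw [norm_smul, ha, mul_one, Real.norm_of_nonneg (by positivity)]
  rw [← hnorm]
  refine EuclideanSpace.norm_le_norm_of_abs_apply_le fun i => ?_
  have hai : |a i| ≤ 1 := ha ▸ PiLp.norm_apply_le a i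
  obtain ⟨hl, hu⟩ := abs_le.1 hai
  have hsub : ‖a - EuclideanSpace.single i (h / 2)‖ ^ 2 = 1 - h * a i + h ^ 2 / 4 := by
    rw [norm_sub_sq_real, ha, EuclideanSpace.inner_single_right, PiLp.norm_single,
      Real.norm_eq_abs, sq_abs]
    simp
    ring
  have hadd : ‖a + EuclideanSpace.single i (h / 2)‖ ^ 2 = 1 + h * a i + h ^ 2 / 4 := by
    rw [norm_add_sq_real, ha, EuclideanSpace.inner_single_right, PiLp.norm_single,
      Real.norm_eq_abs, sq_abs]
    simp
    ring
  have hl' : -h ≤ h * a i := by nlinarith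
  have hu' : h * a i ≤ h := by nlinarith
  have hbd : Set.Icc (1 - h + h ^ 2 / 4) (1 + h + h ^ 2 / 4) ⊆ Set.Icc (0 : ℝ) 4 :=
    Set.Icc_subset_Icc (by nlinarith [sq_nonneg (1 - h / 2)]) (by nlinarith)
  have hs : 1 - h * a i + h ^ 2 / 4 ∈ Set.Icc (1 - h + h ^ 2 / 4) (1 + h + h ^ 2 / 4) :=
    ⟨by linarith, by linarith⟩
  have ht : 1 + h * a i + h ^ 2 / 4 ∈ Set.Icc (1 - h + h ^ 2 / 4) (1 + h + h ^ 2 / 4) :=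
    ⟨by linarith, by linarith⟩
  have key := mul_abs_sub_le_of_le_hasDerivWithinAt (M := M) hg (hbd hs) (hbd ht) fun x hx => by
    have hx' := Set.uIcc_subset_Icc hs ht hx
    have h1 := (abs_le.1 (hlip x (hbd hx') 1 (by norm_num))).1
    have h2 : |x - 1| ≤ h + h ^ 2 / 4 :=
      abs_le.2 ⟨by linarith [hx'.1, sq_nonneg h], by linarith [hx'.2]⟩
    have h3 := mul_le_mul_of_nonneg_left h2 hc₁.le
    linarith
  have hdiff : |1 - h * a i + h ^ 2 / 4 - (1 + h * a i + h ^ 2 / 4)| = 2 * h * |a i| := by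
    rw [show 1 - h * a i + h ^ 2 / 4 - (1 + h * a i + h ^ 2 / 4) = -(2 * h * a i) by ring,
      abs_neg, abs_mul, abs_of_pos (by positivity : 0 < 2 * h)]
  rw [hdiff] at key
  rw [hat, hsub, hadd, abs_div, abs_of_pos hh0, le_div_iff₀ hh0, PiLp.smul_apply, smul_eq_mul,
    abs_mul, abs_of_pos (by positivity : 0 < 2 * M)]
  linarith
end
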